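/- If M is S-Mittag-Leffler with respect to a class Q of R-modules, then M is S-Mittag-Leffler with respect to the class of all direct products of families of modules from Q. -/

import Mathlib

/-- The canonical map `M ⊗[R] (∀ i, N i) →ₗ[R] ∀ i, M ⊗[R] N i`. -/
noncomputable def tensorPiMap (R : Type*) [CommRing R] (M : Type*) [AddCommGroup M]
    [Module R M] {ι : Type*} (N : ι → Type*) [∀ i, AddCommGroup (N i)]
    [∀ i, Module R (N i)] :
    (TensorProduct R M (∀ i, N i)) →ₗ[R] (∀ i, TensorProduct R M (N i)) :=
  LinearMap.pi fun i => LinearMap.lTensor M (LinearMap.proj i)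

/-- `M` is `S`-Mittag-Leffler with respect to a class `Q` of `R`-modules if for every
family of modules in `Q`, the canonical map `M ⊗ ∏ Qᵢ → ∏ (M ⊗ Qᵢ)` has `S`-torsion kernel. -/
def IsSMittagLeffler (R : Type) [CommRing R] (S : Submonoid R) (M : Type) [AddCommGroup M]
    [Module R M] (Q : ModuleCat R → Prop) : Prop :=
  ∀ (ι : Type) (N : ι → ModuleCat R), (∀ i, Q (N i)) →
    ∀ x ∈ LinearMap.ker (tensorPiMap R M fun i => (N i : Type)), ∃ s ∈ S, s • x = 0

/-- `P` is (isomorphic to) a direct product of a family of modules from `Q`. -/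
def IsProductOf {R : Type} [CommRing R] (Q : ModuleCat R → Prop)
    (P : ModuleCat R) : Prop :=
  ∃ (ι : Type) (N : ι → ModuleCat R), (∀ i, Q (N i)) ∧
    Nonempty ((P : Type) ≃ₗ[R] ∀ i, (N i : Type))

theorem s_mittagLeffler_products {R : Type} [CommRing R] (S : Submonoid R)
    {M : Type} [AddCommGroup M] [Module R M] (Q : ModuleCat R → Prop)
    (hM : IsSMittagLeffler R S M Q) :
    IsSMittagLeffler R S M (IsProductOf Q) := by
  intro ι P hP x hx
  choose κ N hN e using hP
  let f : (∀ i, (P i : Type)) ≃ₗ[R] ∀ p : (i : ι) × κ i, (N p.1 p.2 : Type) :=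
    (LinearEquiv.piCongrRight fun i => (e i).some) ≪≫ₗ
      (LinearEquiv.piCurry R fun i j => (N i j : Type)).symm
  have hproj (p : (i : ι) × κ i) :
      LinearMap.proj p ∘ₗ f.toLinearMap =
        (LinearMap.proj p.2 ∘ₗ (e p.1).some.toLinearMap) ∘ₗ LinearMap.proj p.1 := rfl
  have hker : f.lTensor M x ∈
      LinearMap.ker (tensorPiMap R M fun p : (i : ι) × κ i => (N p.1 p.2 : Type)) := by
    rw [LinearMap.mem_ker] at hx ⊢
    funext p
    have hxp : LinearMap.lTensor M (LinearMap.proj p.1) x = 0 := congrFun hx p.1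
    change LinearMap.lTensor M (LinearMap.proj p) (LinearMap.lTensor M f.toLinearMap x) = 0
    rw [← LinearMap.lTensor_comp_apply, hproj, LinearMap.lTensor_comp_apply, hxp, map_zero]
  obtain ⟨s, hs, hsx⟩ := hM _ (fun p : (i : ι) × κ i => N p.1 p.2) (fun p => hN p.1 p.2) _ hker
  refine ⟨s, hs, (f.lTensor M).injective ?_⟩
  rw [map_smul, map_zero]
  exact hsx
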